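/- Let n, ℓ be positive integers and z a point of ℝⁿ lying on the hyperplane H = {x_n = 0}. If 2ℓ > 2k − n for a positive integer k, then the function ζ ↦ |ζ_n|^{2ℓ}/|z − ζ|^{2k} is integrable on any bounded neighborhood of z in ℝⁿ. -/

import Mathlib

open MeasureTheory

theorem stmt_12 (n ℓ k : ℕ) (hn : 0 < n) (hℓ : 0 < ℓ) (hk : 0 < k)
    (hlk : 2 * (k : ℤ) - n < 2 * (ℓ : ℤ))
    (z : EuclideanSpace ℝ (Fin n)) (hz : z ⟨n - 1, Nat.sub_lt hn one_pos⟩ = 0) :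
    ∀ V : Set (EuclideanSpace ℝ (Fin n)), V ∈ nhds z → Bornology.IsBounded V →
      IntegrableOn
        (fun ζ => |ζ ⟨n - 1, Nat.sub_lt hn one_pos⟩| ^ (2 * ℓ) / ‖z - ζ‖ ^ (2 * k)) V := by
  intro V _ hV
  generalize (⟨n - 1, Nat.sub_lt hn one_pos⟩ : Fin n) = i at *
  obtain ⟨r, hr⟩ := hV.subset_ball z
  let g : EuclideanSpace ℝ (Fin n) → ℝ := fun x => |x i| ^ (2 * ℓ) / ‖x‖ ^ (2 * k)
  have hg : IntegrableOn g (Metric.ball 0 r) := by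
    refine integrableOn_ball_of_norm_le_rpow (C := 1) (α := 2 * (k : ℝ) - 2 * ℓ) ?_ ?_ ?_ ?_
    · simpa using Nat.succ_le_of_lt hn
    · simp only [finrank_euclideanSpace, Fintype.card_fin]
      have h : (2 * (k : ℝ) - n < 2 * (ℓ : ℝ)) := by exact_mod_cast hlk
      linarith
    · refine Filter.Eventually.of_forall fun x => ?_
      simp only [g]
      rcases eq_or_ne x 0 with rfl | hx
      · have h : (0 : ℝ) ≤ 1 * ‖(0 : EuclideanSpace ℝ (Fin n))‖ ^ (-(2 * (k : ℝ) - 2 * ℓ)) := by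
          positivity
        simpa [hℓ.ne', hk.ne'] using h
      · have hx' : 0 < ‖x‖ := norm_pos_iff.2 hx
        have h1 : ‖x‖ ^ (-(2 * (k : ℝ) - 2 * ℓ)) = ‖x‖ ^ (2 * ℓ) / ‖x‖ ^ (2 * k) := by
          rw [neg_sub, Real.rpow_sub hx', ← Real.rpow_natCast, ← Real.rpow_natCast]
          push_cast
          rfl
        rw [h1, one_mul, Real.norm_of_nonneg (by positivity)]
        gcongr
        exact PiLp.norm_apply_le x i
    · have : Measurable g := by
        simp only [g]
        fun_prop
      exact this.aestronglyMeasurable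
  have hmp := measurePreserving_sub_right (volume : Measure (EuclideanSpace ℝ (Fin n))) z
  have h2 := (hmp.integrableOn_comp_preimage
    (MeasurableEquiv.subRight z).measurableEmbedding (f := g) (s := Metric.ball 0 r)).2 hg
  have h3 : g ∘ (fun x => x - z) = fun ζ => |ζ i| ^ (2 * ℓ) / ‖z - ζ‖ ^ (2 * k) := by
    funext ζ
    simp [g, hz, norm_sub_rev]
  rw [h3] at h2
  refine h2.mono_set fun x hx => ?_
  have := hr hx
  simpa [dist_eq_norm] using this
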